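/- arXiv:1907.00191 — 5 statements merged into one kernel-verified Lean document; each statement's English description precedes it below -/
import Mathlib

section
/- Let Φ ∈ ℝ^{p×p} be symmetric with Φ − τ I positive semidefinite for some τ > 0, and let G : ℝ^p → ℝ^p be δ-cocoercive with respect to the standard inner product, for some δ > 0. Then the map Φ⁻¹ ∘ G is δτ-cocoercive with respect to the Φ-inner product: for all x, y ∈ ℝ^p, ⟨Φ⁻¹ G(x) − Φ⁻¹ G(y), x − y⟩_Φ ≥ δτ ‖Φ⁻¹ G(x) − Φ⁻¹ G(y)‖²_Φ. -/
open Matrix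

namespace Matrix

variable {n : Type*} [DecidableEq n]

theorem PosSemidef.mul_dotProduct_self_le [Fintype n] {A : Matrix n n ℝ} {τ : ℝ}
    (h : (A - τ • 1).PosSemidef) (w : n → ℝ) : τ * (w ⬝ᵥ w) ≤ w ⬝ᵥ (A *ᵥ w) := by
  have := h.dotProduct_mulVec_nonneg w
  simpa [sub_mulVec, smul_mulVec, dotProduct_sub, dotProduct_smul] using this

theorem PosSemidef.mul_dotProduct_mulVec_le [Fintype n] {A : Matrix n n ℝ} {τ : ℝ} (hτ : 0 ≤ τ)
    (h : (A - τ • 1).PosSemidef) (w : n → ℝ) :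
    τ * (w ⬝ᵥ (A *ᵥ w)) ≤ (A *ᵥ w) ⬝ᵥ (A *ᵥ w) := by
  have hlow := mul_le_mul_of_nonneg_left (h.mul_dotProduct_self_le w) hτ
  have hsq : 0 ≤ (A *ᵥ w - τ • w) ⬝ᵥ (A *ᵥ w - τ • w) := by
    simpa using dotProduct_star_self_nonneg (A *ᵥ w - τ • w)
  simp only [sub_dotProduct, dotProduct_sub, smul_dotProduct, dotProduct_smul, smul_eq_mul,
    dotProduct_comm (A *ᵥ w) w] at hsq
  linarith

theorem PosSemidef.posDef_of_sub_smul_one {A : Matrix n n ℝ} {τ : ℝ} (hτ : 0 < τ)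
    (h : (A - τ • 1).PosSemidef) : A.PosDef := by
  simpa using PosDef.posSemidef_add h (PosDef.one.smul hτ)

end Matrix

/-- If `Φ` is symmetric with `Φ − τ I ⪰ 0`, `τ > 0`,
and `G` is `δ`-cocoercive in the standard inner product, then
`Φ⁻¹ ∘ G` is `δτ`-cocoercive in the `Φ`-inner product
`⟨u, v⟩_Φ = uᵀ Φ v`. -/
theorem stmt6 (p : ℕ) (Φ : Matrix (Fin p) (Fin p) ℝ) (hsymm : Φ.IsSymm)
    (τ : ℝ) (hτ : 0 < τ) (hpsd : (Φ - τ • 1).PosSemidef)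
    (G : (Fin p → ℝ) → (Fin p → ℝ)) (δ : ℝ) (hδ : 0 < δ)
    (hG : ∀ x y : Fin p → ℝ,
      δ * ((G x - G y) ⬝ᵥ (G x - G y)) ≤ (G x - G y) ⬝ᵥ (x - y)) :
    ∀ x y : Fin p → ℝ,
      δ * τ * ((Φ⁻¹ *ᵥ G x - Φ⁻¹ *ᵥ G y) ⬝ᵥ (Φ *ᵥ (Φ⁻¹ *ᵥ G x - Φ⁻¹ *ᵥ G y)))
        ≤ (Φ⁻¹ *ᵥ G x - Φ⁻¹ *ᵥ G y) ⬝ᵥ (Φ *ᵥ (x - y)) := by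
  intro x y
  have hdet : IsUnit Φ.det :=
    (Φ.isUnit_iff_isUnit_det).mp (hpsd.posDef_of_sub_smul_one hτ).isUnit
  rw [← mulVec_sub]
  set w := Φ⁻¹ *ᵥ (G x - G y) with hw
  have hΦw : Φ *ᵥ w = G x - G y := by
    rw [hw, mulVec_mulVec, mul_nonsing_inv _ hdet, one_mulVec]
  have hadj : w ⬝ᵥ (Φ *ᵥ (x - y)) = (Φ *ᵥ w) ⬝ᵥ (x - y) := by
    rw [dotProduct_mulVec, ← mulVec_transpose, hsymm.eq]
  have hG' := hG x y
  rw [← hΦw] at hG'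
  calc δ * τ * (w ⬝ᵥ (Φ *ᵥ w)) = δ * (τ * (w ⬝ᵥ (Φ *ᵥ w))) := mul_assoc ..
    _ ≤ δ * ((Φ *ᵥ w) ⬝ᵥ (Φ *ᵥ w)) :=
      mul_le_mul_of_nonneg_left (hpsd.mul_dotProduct_mulVec_le hτ.le w) hδ.le
    _ ≤ w ⬝ᵥ (Φ *ᵥ (x - y)) := hG'.trans_eq hadj.symm
end

section
/- Let Φ ∈ ℝ^{p×p} be symmetric with Φ − τ I positive semidefinite for some τ > 0, and let G : ℝ^p → ℝ^p be δ-cocoercive with respect to the standard inner product, with δ > 0 and δτ > 1/2. Then the map Id − Φ⁻¹ ∘ G is (1/(2δτ))-averaged with respect to the Φ-induced norm: for all x, y ∈ ℝ^p, writing S := Id − Φ⁻¹ ∘ G and η := 1/(2δτ), one has ‖S x − S y‖²_Φ ≤ ‖x − y‖²_Φ − ((1−η)/η) ‖(x − S x) − (y − S y)‖²_Φ. -/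
open Matrix

/-- If `τ I ⪯ Φ` with `τ > 0`, then `Φ` is positive definite. -/
lemma posDef_of_posSemidef_sub_smul_one {n : Type*} [Finite n] [DecidableEq n]
    {Φ : Matrix n n ℝ} {τ : ℝ} (hτ : 0 < τ) (h : (Φ - τ • 1).PosSemidef) : Φ.PosDef := by
  simpa using (PosDef.one.smul hτ).posSemidef_add h

/-- If `τ I ⪯ Φ` with `τ > 0`, then `τ ⟨w, Φ w⟩ ≤ ‖Φ w‖²`. -/
lemma mul_dotProduct_mulVec_le_of_posSemidef_sub_smul_one {n : Type*} [Fintype n] [DecidableEq n]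
    {Φ : Matrix n n ℝ} {τ : ℝ} (hτ : 0 < τ) (h : (Φ - τ • 1).PosSemidef) (w : n → ℝ) :
    τ * (w ⬝ᵥ (Φ *ᵥ w)) ≤ (Φ *ᵥ w) ⬝ᵥ (Φ *ᵥ w) := by
  have hlower := h.dotProduct_mulVec_nonneg w
  simp only [star_trivial, sub_mulVec, smul_mulVec, one_mulVec, dotProduct_sub,
    dotProduct_smul, smul_eq_mul] at hlower
  have hsq : 0 ≤ (Φ *ᵥ w - τ • w) ⬝ᵥ (Φ *ᵥ w - τ • w) := by
    simpa using dotProduct_star_self_nonneg (Φ *ᵥ w - τ • w)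
  simp only [sub_dotProduct, dotProduct_sub, smul_dotProduct, dotProduct_smul, smul_eq_mul,
    dotProduct_comm (Φ *ᵥ w) w] at hsq
  nlinarith [mul_nonneg hτ.le hlower]

/-- If `Φ` is symmetric with `Φ − τ I ⪰ 0`, `τ > 0`, and
`G` is `δ`-cocoercive (standard inner product) with `δτ > 1/2`, then
`S := Id − Φ⁻¹ ∘ G` is `(1/(2δτ))`-averaged in the `Φ`-induced norm
`‖u‖²_Φ = uᵀ Φ u`. -/
theorem stmt7 (p : ℕ) (Φ : Matrix (Fin p) (Fin p) ℝ) (hsymm : Φ.IsSymm)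
    (τ : ℝ) (hτ : 0 < τ) (hpsd : (Φ - τ • 1).PosSemidef)
    (G : (Fin p → ℝ) → (Fin p → ℝ)) (δ : ℝ) (hδ : 0 < δ) (hδτ : 1 / 2 < δ * τ)
    (hG : ∀ x y : Fin p → ℝ,
      δ * ((G x - G y) ⬝ᵥ (G x - G y)) ≤ (G x - G y) ⬝ᵥ (x - y))
    (S : (Fin p → ℝ) → (Fin p → ℝ)) (hS : S = fun x => x - Φ⁻¹ *ᵥ G x)
    (η : ℝ) (hη : η = 1 / (2 * δ * τ)) :
    ∀ x y : Fin p → ℝ,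
      (S x - S y) ⬝ᵥ (Φ *ᵥ (S x - S y))
        ≤ (x - y) ⬝ᵥ (Φ *ᵥ (x - y)) -
          (1 - η) / η *
            (((x - S x) - (y - S y)) ⬝ᵥ (Φ *ᵥ ((x - S x) - (y - S y)))) := by
  intro x y
  have hunit : IsUnit Φ.det :=
    (isUnit_iff_isUnit_det Φ).1 (posDef_of_posSemidef_sub_smul_one hτ hpsd).isUnit
  set d := x - y with hd
  set w := Φ⁻¹ *ᵥ (G x - G y) with hw
  have hΦw : Φ *ᵥ w = G x - G y := by
    rw [hw, mulVec_mulVec, mul_nonsing_inv _ hunit, one_mulVec]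
  have hdiff : S x - S y = d - w := by
    simp only [hS, hw, mulVec_sub, hd]
    abel
  have hres : (x - S x) - (y - S y) = w := by
    simp only [hS, hw, mulVec_sub]
    abel
  have hcoef : (1 - η) / η = 2 * δ * τ - 1 := by
    rw [hη]
    field_simp
  have hcoco := hG x y
  rw [← hΦw, ← hd, dotProduct_comm (Φ *ᵥ w) d] at hcoco
  have hsmooth := mul_le_mul_of_nonneg_left
    (mul_dotProduct_mulVec_le_of_posSemidef_sub_smul_one hτ hpsd w) hδ.le
  have hswap : w ⬝ᵥ (Φ *ᵥ d) = d ⬝ᵥ (Φ *ᵥ w) := by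
    rw [dotProduct_mulVec, ← mulVec_transpose, hsymm.eq, dotProduct_comm]
  rw [hdiff, hres, hcoef, mulVec_sub, sub_dotProduct, dotProduct_sub, dotProduct_sub, hswap]
  linarith
end

section
/- Let ρ ∈ (0, 1), let (γ^k)_{k∈ℕ} be a nonincreasing sequence with 0 ≤ γ^{k+1} ≤ γ^k ≤ 1 for all k and ∑_{k=0}^∞ (γ^k)² < ∞, let a₁, a₂, a₃, a₄, δ₁, δ₂ ≥ 0, and define φ^k := δ₁ ρ^{k−1} + δ₂ ∑_{ℓ=1}^k ρ^{k−ℓ} γ^{ℓ−1} for k ≥ 0. If (e^k)_{k∈ℕ} is a sequence of nonnegative reals satisfying e^k ≤ a₁ ρ^k + a₂ ∑_{s=1}^k ρ^{k−s} γ^{s−1} + a₃ φ^k + a₄ ∑_{s=1}^k ρ^{k−s} φ^{s−1} for all k ≥ 0, then ∑_{k=0}^∞ γ^k e^k < ∞. -/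
/-- A nonnegative sequence contracting up to a summable error is summable. -/
theorem summable_of_contraction_add_summable {r : ℝ} (hr1 : r < 1) {x b : ℕ → ℝ}
    (hx : ∀ k, 0 ≤ x k) (hb : ∀ k, 0 ≤ b k) (hsum : Summable b)
    (h : ∀ k, x (k + 1) ≤ r * x k + b k) : Summable x := by
  have hpos : 0 < 1 - r := sub_pos.2 hr1
  have key : ∀ n, ∑ k ∈ Finset.range n, x k ≤ (x 0 + ∑' k, b k) / (1 - r) := by
    intro n
    rw [le_div_iff₀ hpos]
    have h1 : ∑ k ∈ Finset.range n, x (k + 1)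
        ≤ r * ∑ k ∈ Finset.range n, x k + ∑ k ∈ Finset.range n, b k := by
      rw [Finset.mul_sum, ← Finset.sum_add_distrib]
      exact Finset.sum_le_sum fun k _ => h k
    have h2 := Finset.sum_range_succ' x n
    have h3 := Finset.sum_range_succ x n
    have h4 : ∑ k ∈ Finset.range n, b k ≤ ∑' k, b k :=
      hsum.sum_le_tsum _ fun k _ => hb k
    have h5 := hx n
    linarith
  exact summable_of_sum_range_le hx key

/-- Geometric convolution preserves square-summability. -/
theorem summable_sq_geometric_convolution {r : ℝ} (hr0 : 0 < r) (hr1 : r < 1) {f : ℕ → ℝ}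
    (hf : Summable fun k => f k ^ 2) :
    Summable fun k => (∑ s ∈ Finset.Icc 1 k, r ^ (k - s) * f (s - 1)) ^ 2 := by
  have hpos : 0 < 1 - r := sub_pos.2 hr1
  refine summable_of_contraction_add_summable hr1 (b := fun k => f k ^ 2 / (1 - r))
    (fun k => sq_nonneg _) (fun k => by positivity) (hf.div_const _) fun k => ?_
  have hrec : ∑ s ∈ Finset.Icc 1 (k + 1), r ^ (k + 1 - s) * f (s - 1)
      = r * ∑ s ∈ Finset.Icc 1 k, r ^ (k - s) * f (s - 1) + f k := by
    rw [Finset.sum_Icc_succ_top (by omega), Finset.mul_sum]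
    congr 1
    · refine Finset.sum_congr rfl fun s hs => ?_
      rw [Nat.sub_add_comm (Finset.mem_Icc.1 hs).2, pow_succ]
      ring
    · simp
  rw [hrec]
  generalize ∑ s ∈ Finset.Icc 1 k, r ^ (k - s) * f (s - 1) = c
  have hid : r * c ^ 2 + f k ^ 2 / (1 - r) - (r * c + f k) ^ 2
      = r / (1 - r) * ((1 - r) * c - f k) ^ 2 := by
    field_simp
    ring
  have : 0 ≤ r / (1 - r) * ((1 - r) * c - f k) ^ 2 := by positivity
  linarith

theorem summable_sq_const_mul {f : ℕ → ℝ} (c : ℝ) (hf : Summable fun k => f k ^ 2) :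
    Summable fun k => (c * f k) ^ 2 := by
  simpa only [mul_pow] using hf.mul_left (c ^ 2)

theorem summable_sq_add {f g : ℕ → ℝ} (hf : Summable fun k => f k ^ 2)
    (hg : Summable fun k => g k ^ 2) : Summable fun k => (f k + g k) ^ 2 :=
  Summable.of_nonneg_of_le (fun k => sq_nonneg _)
    (fun k => show _ ≤ 2 * f k ^ 2 + 2 * g k ^ 2 by nlinarith [sq_nonneg (f k - g k)])
    ((hf.mul_left 2).add (hg.mul_left 2))


/-- Summability of the relaxed error sequence: with
`ρ ∈ (0,1)`, `γ` nonincreasing, `0 ≤ γ^{k+1} ≤ γ^k ≤ 1`, `∑ (γ^k)² < ∞`,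
`φ^k = δ₁ ρ^{k−1} + δ₂ ∑_{ℓ=1}^k ρ^{k−ℓ} γ^{ℓ−1}` (with `ρ^{−1} = 1/ρ`
for `k = 0`), and
`e^k ≤ a₁ ρ^k + a₂ ∑_{s=1}^k ρ^{k−s} γ^{s−1} + a₃ φ^k + a₄ ∑_{s=1}^k ρ^{k−s} φ^{s−1}`,
one has `∑ γ^k e^k < ∞`. -/
theorem stmt15 (ρ : ℝ) (hρ : ρ ∈ Set.Ioo (0 : ℝ) 1)
    (γ : ℕ → ℝ) (hγ0 : ∀ k, 0 ≤ γ (k + 1)) (hγmono : ∀ k, γ (k + 1) ≤ γ k)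
    (hγ1 : ∀ k, γ k ≤ 1) (hγsq : Summable fun k => (γ k) ^ 2)
    (a₁ a₂ a₃ a₄ δ₁ δ₂ : ℝ)
    (ha₁ : 0 ≤ a₁) (ha₂ : 0 ≤ a₂) (ha₃ : 0 ≤ a₃) (ha₄ : 0 ≤ a₄)
    (hδ₁ : 0 ≤ δ₁) (hδ₂ : 0 ≤ δ₂)
    (φ : ℕ → ℝ)
    (hφ : ∀ k, φ k = δ₁ * ρ ^ ((k : ℤ) - 1) +
      δ₂ * ∑ ℓ ∈ Finset.Icc 1 k, ρ ^ (k - ℓ) * γ (ℓ - 1))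
    (e : ℕ → ℝ) (he : ∀ k, 0 ≤ e k)
    (heb : ∀ k, e k ≤ a₁ * ρ ^ k + a₂ * ∑ s ∈ Finset.Icc 1 k, ρ ^ (k - s) * γ (s - 1)
      + a₃ * φ k + a₄ * ∑ s ∈ Finset.Icc 1 k, ρ ^ (k - s) * φ (s - 1)) :
    Summable fun k => γ k * e k := by
  obtain ⟨hρ0, hρ1⟩ := hρ
  have hγ : ∀ k, 0 ≤ γ k := fun k => (hγ0 k).trans (hγmono k)
  have hpow : Summable fun k : ℕ => (ρ ^ k) ^ 2 := by
    simp_rw [← pow_mul, mul_comm _ 2, pow_mul]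
    exact summable_geometric_of_lt_one (sq_nonneg _) (by nlinarith)
  have hconv := summable_sq_geometric_convolution hρ0 hρ1 hγsq
  have hφsq : Summable fun k => φ k ^ 2 := by
    have h := summable_sq_add (summable_sq_const_mul (δ₁ * ρ⁻¹) hpow)
      (summable_sq_const_mul δ₂ hconv)
    refine h.congr fun k => ?_
    rw [hφ k, zpow_sub_one₀ hρ0.ne', zpow_natCast]
    ring
  have hbound := summable_sq_add (summable_sq_add (summable_sq_add
    (summable_sq_const_mul a₁ hpow) (summable_sq_const_mul a₂ hconv))
    (summable_sq_const_mul a₃ hφsq))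
    (summable_sq_const_mul a₄ (summable_sq_geometric_convolution hρ0 hρ1 hφsq))
  have hesq : Summable fun k => e k ^ 2 :=
    hbound.of_nonneg_of_le (fun k => sq_nonneg _) fun k => pow_le_pow_left₀ (he k) (heb k) 2
  exact (hγsq.add hesq).of_nonneg_of_le (fun k => mul_nonneg (hγ k) (he k))
    fun k => by nlinarith [sq_nonneg (γ k - e k), sq_nonneg (γ k), sq_nonneg (e k)]
end

section
/- Let ρ ∈ (0, 1) and let (γ^k)_{k∈ℕ} be a nonnegative nonincreasing sequence with ∑_{k=0}^∞ (γ^k)² < ∞. Then ∑_{k=0}^∞ γ^k ∑_{s=1}^k ρ^{k−s} γ^{s−1} < ∞. -/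
/-- If `ρ ∈ (0,1)` and `γ` is nonnegative,
nonincreasing and square-summable, then
`∑_k γ^k ∑_{s=1}^k ρ^{k−s} γ^{s−1} < ∞`. -/
theorem stmt16 (ρ : ℝ) (hρ : ρ ∈ Set.Ioo (0 : ℝ) 1)
    (γ : ℕ → ℝ) (hγ0 : ∀ k, 0 ≤ γ k) (hγmono : ∀ k, γ (k + 1) ≤ γ k)
    (hγsq : Summable fun k => (γ k) ^ 2) :
    Summable fun k => γ k * ∑ s ∈ Finset.Icc 1 k, ρ ^ (k - s) * γ (s - 1) := by
  have hρ0 : 0 ≤ ρ := hρ.1.le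
  have hanti : Antitone γ := antitone_nat_of_succ_le hγmono
  have hgeom : Summable fun k : ℕ => ρ ^ k := summable_geometric_of_lt_one hρ0 hρ.2
  have hconv := (summable_norm_sum_mul_range_of_summable_norm hγsq.norm hgeom.norm).of_norm
  rw [← summable_nat_add_iff 1]
  refine hconv.of_nonneg_of_le
    (fun k => mul_nonneg (hγ0 _) (Finset.sum_nonneg fun s _ => by
      have := hγ0 (s - 1)
      positivity)) fun k => ?_
  have hshift : ∑ s ∈ Finset.Icc 1 (k + 1), ρ ^ (k + 1 - s) * γ (s - 1) =
      ∑ i ∈ Finset.range (k + 1), ρ ^ (k - i) * γ i := by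
    rw [← Finset.Ico_add_one_right_eq_Icc, Finset.sum_Ico_eq_sum_range]
    refine Finset.sum_congr rfl fun i _ => ?_
    rw [Nat.add_sub_cancel_left, Nat.add_comm 1 i, Nat.add_sub_add_right]
  rw [hshift, Finset.mul_sum]
  refine Finset.sum_le_sum fun i hi => ?_
  have hle : γ (k + 1) ≤ γ i := hanti (Finset.mem_range.mp hi).le
  calc γ (k + 1) * (ρ ^ (k - i) * γ i) ≤ γ i * (ρ ^ (k - i) * γ i) :=
        mul_le_mul_of_nonneg_right hle (mul_nonneg (pow_nonneg hρ0 _) (hγ0 i))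
    _ = γ i ^ 2 * ρ ^ (k - i) := by ring
end

section
/- Let ρ ∈ (0, 1), let (γ^k)_{k∈ℕ} be a nonincreasing sequence with 0 ≤ γ^{k+1} ≤ γ^k ≤ 1 for all k and ∑_{k=0}^∞ (γ^k)² < ∞, let δ₁, δ₂ ≥ 0, and define φ^k := δ₁ ρ^{k−1} + δ₂ ∑_{ℓ=1}^k ρ^{k−ℓ} γ^{ℓ−1}. Then ∑_{k=0}^∞ γ^k φ^k < ∞. -/
/-- With `ρ ∈ (0,1)`, `γ` nonincreasing,
`0 ≤ γ^{k+1} ≤ γ^k ≤ 1`, `∑ (γ^k)² < ∞`, `δ₁, δ₂ ≥ 0` and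
`φ^k = δ₁ ρ^{k−1} + δ₂ ∑_{ℓ=1}^k ρ^{k−ℓ} γ^{ℓ−1}` (with `ρ^{−1} = 1/ρ`
for `k = 0`), one has `∑ γ^k φ^k < ∞`. -/
theorem stmt17 (ρ : ℝ) (hρ : ρ ∈ Set.Ioo (0 : ℝ) 1)
    (γ : ℕ → ℝ) (hγ0 : ∀ k, 0 ≤ γ (k + 1)) (hγmono : ∀ k, γ (k + 1) ≤ γ k)
    (hγ1 : ∀ k, γ k ≤ 1) (hγsq : Summable fun k => (γ k) ^ 2)
    (δ₁ δ₂ : ℝ) (hδ₁ : 0 ≤ δ₁) (hδ₂ : 0 ≤ δ₂)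
    (φ : ℕ → ℝ)
    (hφ : ∀ k, φ k = δ₁ * ρ ^ ((k : ℤ) - 1) +
      δ₂ * ∑ ℓ ∈ Finset.Icc 1 k, ρ ^ (k - ℓ) * γ (ℓ - 1)) :
    Summable fun k => γ k * φ k := by
  obtain ⟨hρ0, hρ1⟩ := hρ
  have hγ : ∀ k, 0 ≤ γ k := fun k => (hγ0 k).trans (hγmono k)
  have hanti : Antitone γ := antitone_nat_of_succ_le hγmono
  have hgeom : Summable fun k : ℕ => ρ ^ k := summable_geometric_of_lt_one hρ0.le hρ1
  have hconv : Summable fun n => ∑ i ∈ Finset.range (n + 1), γ i ^ 2 * ρ ^ (n - i) :=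
    (summable_norm_sum_mul_range_of_summable_norm hγsq.norm hgeom.norm).of_norm
  rw [← summable_nat_add_iff 1]
  refine Summable.of_nonneg_of_le (fun n => ?_) (fun n => ?_)
    ((hgeom.mul_left δ₁).add (hconv.mul_left δ₂))
  · rw [hφ]
    refine mul_nonneg (hγ _) (add_nonneg (mul_nonneg hδ₁ (zpow_nonneg hρ0.le _))
      (mul_nonneg hδ₂ (Finset.sum_nonneg fun i _ => ?_)))
    exact mul_nonneg (pow_nonneg hρ0.le _) (hγ _)
  · have hz : ρ ^ (((n + 1 : ℕ) : ℤ) - 1) = ρ ^ n := by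
      rw [Nat.cast_succ, add_sub_cancel_right, zpow_natCast]
    have hs : ∑ ℓ ∈ Finset.Icc 1 (n + 1), ρ ^ (n + 1 - ℓ) * γ (ℓ - 1) =
        ∑ i ∈ Finset.range (n + 1), ρ ^ (n - i) * γ i := by
      rw [← Finset.Ico_add_one_right_eq_Icc, Finset.sum_Ico_eq_sum_range]
      refine Finset.sum_congr (by simp) fun i _ => ?_
      rw [show n + 1 - (1 + i) = n - i by omega, Nat.add_sub_cancel_left]
    rw [hφ, hz, hs, mul_add]
    refine add_le_add (mul_le_of_le_one_left (mul_nonneg hδ₁ (pow_nonneg hρ0.le _)) (hγ1 _)) ?_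
    rw [mul_left_comm, Finset.mul_sum]
    refine mul_le_mul_of_nonneg_left (Finset.sum_le_sum fun i hi => ?_) hδ₂
    have hle : γ (n + 1) ≤ γ i := hanti (Finset.mem_range.mp hi).le
    calc γ (n + 1) * (ρ ^ (n - i) * γ i) ≤ γ i * (ρ ^ (n - i) * γ i) :=
          mul_le_mul_of_nonneg_right hle (mul_nonneg (pow_nonneg hρ0.le _) (hγ i))
      _ = γ i ^ 2 * ρ ^ (n - i) := by ring
end
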